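/- Let Ω be either ℝ^n or a cube in ℝ^n with sides parallel to the axes, and let 0 < r < ∞ and 1 ≤ p < ∞. Then 𝓜^r_{A_p}(Ω) equals the union over s > r of 𝓜^s_{A_p}(Ω); and, if in addition p > 1, 𝓜^r_{A_p}(Ω) also equals the union over 1 ≤ q < p of 𝓜^r_{A_q}(Ω). -/

import Mathlib

open MeasureTheory ENNReal

/-- A (nondegenerate) cube in `ℝⁿ` with sides parallel to the axes. -/
def IsCube {n : ℕ} (Q : Set (Fin n → ℝ)) : Prop :=
  ∃ (a : Fin n → ℝ) (l : ℝ), 0 < l ∧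
    Q = Set.univ.pi fun i => Set.Icc (a i) (a i + l)

/-- The domains considered: all of `ℝⁿ` or a cube with sides parallel to the axes. -/
def IsAdmissibleDomain {n : ℕ} (Ω : Set (Fin n → ℝ)) : Prop :=
  Ω = Set.univ ∨ IsCube Ω

/-- The Hardy–Littlewood maximal operator restricted to `Ω`:
`M_Ω f (x) = sup { (1/|Q|) ∫_Q |f| : Q ⊆ Ω a cube with x ∈ Q }`. -/
noncomputable def maximal {n : ℕ} (Ω : Set (Fin n → ℝ)) (f : (Fin n → ℝ) → ℝ)
    (x : Fin n → ℝ) : ℝ≥0∞ :=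
  ⨆ (Q : Set (Fin n → ℝ)) (_ : IsCube Q) (_ : Q ⊆ Ω) (_ : x ∈ Q),
    (volume Q)⁻¹ * ∫⁻ y in Q, ENNReal.ofReal |f y|

/-- A weight on `Ω`: a measurable function, positive a.e. on `Ω`, integrable on every
cube contained in `Ω` (hence locally integrable; integrable when `Ω` is itself a cube). -/
structure IsWeight {n : ℕ} (Ω : Set (Fin n → ℝ)) (w : (Fin n → ℝ) → ℝ) : Prop where
  measurable : Measurable w
  pos : ∀ᵐ x ∂(volume.restrict Ω), 0 < w x
  locInt : ∀ Q : Set (Fin n → ℝ), IsCube Q → Q ⊆ Ω → IntegrableOn w Q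

/-- The Muckenhoupt `A₁(Ω)` class: `M_Ω w ≤ C w` a.e. on `Ω`. -/
def MemA1 {n : ℕ} (Ω : Set (Fin n → ℝ)) (w : (Fin n → ℝ) → ℝ) : Prop :=
  IsWeight Ω w ∧ ∃ C : ℝ, ∀ᵐ x ∂(volume.restrict Ω),
    maximal Ω w x ≤ ENNReal.ofReal (C * w x)

/-- The Muckenhoupt `A_p(Ω)` class for `1 < p < ∞`:
`sup_{Q ⊆ Ω} (avg_Q w) * (avg_Q w^(1-p'))^(p-1) < ∞` where `p' = p/(p-1)`. -/
def MemApGT1 {n : ℕ} (Ω : Set (Fin n → ℝ)) (p : ℝ) (w : (Fin n → ℝ) → ℝ) : Prop :=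
  IsWeight Ω w ∧ ∃ C : ℝ≥0∞, C ≠ ∞ ∧ ∀ Q : Set (Fin n → ℝ), IsCube Q → Q ⊆ Ω →
    ((volume Q)⁻¹ * ∫⁻ x in Q, ENNReal.ofReal (w x)) *
      ((volume Q)⁻¹ * ∫⁻ x in Q, ENNReal.ofReal (w x ^ (1 - p / (p - 1)))) ^ (p - 1) ≤ C

/-- The Muckenhoupt `A_p(Ω)` class for `1 ≤ p < ∞`. -/
def MemA {n : ℕ} (Ω : Set (Fin n → ℝ)) (p : ℝ) (w : (Fin n → ℝ) → ℝ) : Prop :=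
  (p = 1 ∧ MemA1 Ω w) ∨ (1 < p ∧ MemApGT1 Ω p w)

/-- The Muckenhoupt `A_∞(Ω)` class: the union of `A_p(Ω)` over `1 ≤ p < ∞`. -/
def MemAInf {n : ℕ} (Ω : Set (Fin n → ℝ)) (w : (Fin n → ℝ) → ℝ) : Prop :=
  ∃ p : ℝ, 1 ≤ p ∧ MemA Ω p w

/-- Membership in the weighted Lebesgue space `L^p_w(Ω)`: `f` measurable with
`∫_Ω |f|^p w < ∞`. -/
def MemLw {n : ℕ} (Ω : Set (Fin n → ℝ)) (p : ℝ) (w f : (Fin n → ℝ) → ℝ) : Prop :=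
  Measurable f ∧
    ∫⁻ x in Ω, ENNReal.ofReal |f x| ^ p * ENNReal.ofReal (w x) < ⊤

/-- Membership in the (unweighted) Lebesgue space `L^p(Ω)`. -/
def MemLeb {n : ℕ} (Ω : Set (Fin n → ℝ)) (p : ℝ) (f : (Fin n → ℝ) → ℝ) : Prop :=
  MemLw Ω p (fun _ => 1) f

/-- `f ∈ 𝓜_{A_p}(Ω)`: `f` is measurable and `|f| ≤ w` a.e. on `Ω` for some `w ∈ A_p(Ω)`. -/
def HasApMajorant {n : ℕ} (Ω : Set (Fin n → ℝ)) (p : ℝ) (f : (Fin n → ℝ) → ℝ) : Prop :=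
  Measurable f ∧ ∃ w, MemA Ω p w ∧ ∀ᵐ x ∂(volume.restrict Ω), |f x| ≤ w x

/-- `f ∈ 𝓜^r_{A_p}(Ω)`: `f` is measurable and `|f|^r ≤ w` a.e. on `Ω` for some
`w ∈ A_p(Ω)`. -/
def HasApPowMajorant {n : ℕ} (Ω : Set (Fin n → ℝ)) (p r : ℝ) (f : (Fin n → ℝ) → ℝ) : Prop :=
  Measurable f ∧ ∃ w, MemA Ω p w ∧ ∀ᵐ x ∂(volume.restrict Ω), |f x| ^ r ≤ w x

/-- `f ∈ 𝓜_{A_∞}(Ω)`: `f` is measurable and `|f| ≤ w` a.e. on `Ω` for some `w ∈ A_∞(Ω)`. -/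
def HasAInfMajorant {n : ℕ} (Ω : Set (Fin n → ℝ)) (f : (Fin n → ℝ) → ℝ) : Prop :=
  Measurable f ∧ ∃ w, MemAInf Ω w ∧ ∀ᵐ x ∂(volume.restrict Ω), |f x| ≤ w x

/-- Membership in weak `L^p(ℝⁿ)`: `sup_{t>0} t · |{|f| > t}|^{1/p} < ∞`. -/
def MemWeakLp {n : ℕ} (p : ℝ) (f : (Fin n → ℝ) → ℝ) : Prop :=
  Measurable f ∧ ∃ C : ℝ≥0∞, C ≠ ⊤ ∧ ∀ t : ℝ, 0 < t →
    ENNReal.ofReal t * volume {x | t < |f x|} ^ (1 / p) ≤ C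


lemma lintegral_rpow_one_add_le_of_distribution {α : Type*} [MeasurableSpace α] (μ : Measure α)
    {g : α → ℝ} (hg : Measurable g) (hg0 : 0 ≤ᵐ[μ] g) {A a β ε : ℝ} (hA : 0 ≤ A) (ha : 0 ≤ a)
    (hβ : 0 < β) (hε : 0 < ε) (hsmall : ε * A ≤ β ^ (1 + ε) / 2)
    (hfin : ∫⁻ x, ENNReal.ofReal (g x ^ (1 + ε)) ∂μ ≠ ∞)
    (hdist : ∀ t, 0 < t → a ≤ t → ∫⁻ x in {x | t < g x}, ENNReal.ofReal (g x) ∂μ ≤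
      ENNReal.ofReal (A * t) * μ {x | β * t < g x}) :
    ∫⁻ x, ENNReal.ofReal (g x ^ (1 + ε)) ∂μ ≤
      2 * (ENNReal.ofReal (a ^ ε) * ∫⁻ x, ENNReal.ofReal (g x) ∂μ) := by
  set ν := μ.withDensity fun x => ENNReal.ofReal (g x) with hν
  have hνμ : ν ≪ μ := withDensity_absolutelyContinuous _ _
  have hX : ∫⁻ x, ENNReal.ofReal (g x ^ (1 + ε)) ∂μ = ∫⁻ x, ENNReal.ofReal (g x ^ ε) ∂ν := by
    rw [hν, lintegral_withDensity_eq_lintegral_mul _ hg.ennreal_ofReal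
      (hg.pow_const ε).ennreal_ofReal]
    refine lintegral_congr_ae ?_
    filter_upwards [hg0] with x hx
    simp only [Pi.mul_apply]
    rw [← ENNReal.ofReal_mul hx, Real.rpow_add' hx (by positivity), Real.rpow_one]
  have hY : ∫⁻ _, ENNReal.ofReal (a ^ ε) ∂ν =
      ENNReal.ofReal (a ^ ε) * ∫⁻ x, ENNReal.ofReal (g x) ∂μ := by
    rw [lintegral_const, hν, withDensity_apply _ MeasurableSet.univ, Measure.restrict_univ]
  have hZ : ∫⁻ x, ENNReal.ofReal ((g x / β) ^ (1 + ε)) ∂μ =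
      ENNReal.ofReal ((β ^ (1 + ε))⁻¹) * ∫⁻ x, ENNReal.ofReal (g x ^ (1 + ε)) ∂μ := by
    rw [← lintegral_const_mul _ (hg.pow_const _).ennreal_ofReal]
    refine lintegral_congr_ae ?_
    filter_upwards [hg0] with x hx
    rw [← ENNReal.ofReal_mul (by positivity), Real.div_rpow hx hβ.le, div_eq_inv_mul]
  have key : ∫⁻ x, ENNReal.ofReal (g x ^ ε) ∂ν ≤
      ENNReal.ofReal (1 / 2) * ∫⁻ x, ENNReal.ofReal (g x ^ (1 + ε)) ∂μ +
        ∫⁻ _, ENNReal.ofReal (a ^ ε) ∂ν := by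
    have hgβ0 : 0 ≤ᵐ[μ] fun x => g x / β := by
      filter_upwards [hg0] with x hx using div_nonneg hx hβ.le
    have m1 : Measurable fun t : ℝ => μ {x | t < g x / β} :=
      Antitone.measurable fun s t hst => measure_mono fun x hx => lt_of_le_of_lt hst hx
    have m2 : Measurable fun t : ℝ =>
        μ {x | t < g x / β} * ENNReal.ofReal (t ^ ((1 + ε) - 1)) := m1.mul (by fun_prop)
    calc ∫⁻ x, ENNReal.ofReal (g x ^ ε) ∂ν
        = ENNReal.ofReal ε *
            ∫⁻ t in Set.Ioi 0, ν {x | t < g x} * ENNReal.ofReal (t ^ (ε - 1)) :=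
          lintegral_rpow_eq_lintegral_meas_lt_mul ν (hνμ.ae_le hg0) hg.aemeasurable hε
      _ ≤ ENNReal.ofReal ε * ∫⁻ t in Set.Ioi 0,
            (ENNReal.ofReal A * (μ {x | t < g x / β} * ENNReal.ofReal (t ^ ((1 + ε) - 1))) +
              ν {_x | t < a} * ENNReal.ofReal (t ^ (ε - 1))) := by
          refine mul_le_mul' le_rfl ?_
          refine setLIntegral_mono' measurableSet_Ioi fun t (ht : 0 < t) => ?_
          have e : ENNReal.ofReal (t ^ ((1 + ε) - 1)) =
              ENNReal.ofReal t * ENNReal.ofReal (t ^ (ε - 1)) := by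
            rw [← ENNReal.ofReal_mul ht.le, add_sub_assoc, Real.rpow_add ht, Real.rpow_one]
          rcases lt_or_ge t a with hta | hta
          · refine le_add_left ?_
            exact mul_le_mul' (measure_mono fun _ _ => hta) le_rfl
          · refine le_add_right ?_
            rw [e, ← mul_assoc, ← mul_assoc]
            gcongr
            rw [hν, withDensity_apply _ (measurableSet_lt measurable_const hg)]
            refine (hdist t ht hta).trans_eq ?_
            rw [ENNReal.ofReal_mul hA, mul_assoc, mul_assoc, mul_comm (ENNReal.ofReal t)]
            simp_rw [lt_div_iff₀ hβ, mul_comm t β]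
      _ = ENNReal.ofReal (ε * A / (1 + ε)) * ∫⁻ x, ENNReal.ofReal ((g x / β) ^ (1 + ε)) ∂μ +
            ∫⁻ _, ENNReal.ofReal (a ^ ε) ∂ν := by
          rw [lintegral_rpow_eq_lintegral_meas_lt_mul ν (Filter.Eventually.of_forall fun _ => ha)
            aemeasurable_const hε, lintegral_rpow_eq_lintegral_meas_lt_mul μ hgβ0
            (hg.div_const β).aemeasurable (by positivity : 0 < 1 + ε),
            lintegral_add_left (m2.const_mul _), lintegral_const_mul _ m2, mul_add,
            ← mul_assoc, ← mul_assoc, ← ENNReal.ofReal_mul hε.le,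
            ← ENNReal.ofReal_mul (by positivity), div_mul_cancel₀ _ (by positivity)]
      _ ≤ _ := by
          rw [hZ, ← mul_assoc, ← ENNReal.ofReal_mul (by positivity)]
          gcongr
          have hp : 0 < β ^ (1 + ε) := by positivity
          rw [← div_eq_mul_inv, div_div, div_le_iff₀ (by positivity)]
          nlinarith
  rw [← hX, hY] at key
  set X := ∫⁻ x, ENNReal.ofReal (g x ^ (1 + ε)) ∂μ
  set Y := ENNReal.ofReal (a ^ ε) * ∫⁻ x, ENNReal.ofReal (g x) ∂μ
  have h2 : X = ENNReal.ofReal (1 / 2) * X + ENNReal.ofReal (1 / 2) * X := by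
    rw [← add_mul, ← ENNReal.ofReal_add (by norm_num) (by norm_num)]
    norm_num
  have h3 : ENNReal.ofReal (1 / 2) * X ≤ Y := by
    exact (ENNReal.add_le_add_iff_left (a := ENNReal.ofReal (1 / 2) * X)
      (ENNReal.mul_ne_top ofReal_ne_top hfin)).1 (h2.symm.trans_le key)
  calc X = 2 * (ENNReal.ofReal (1 / 2) * X) := by rw [two_mul]; exact h2
    _ ≤ 2 * Y := by gcongr

lemma exists_closedBall_inter_subset {n : ℕ} {c x : Fin n → ℝ} {R s : ℝ}
    (hx : x ∈ Metric.closedBall c R) (hs : 0 ≤ s) (hsR : s ≤ R) :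
    ∃ z, dist z c ≤ R - s ∧ x ∈ Metric.closedBall z s ∧
      Metric.closedBall x s ∩ Metric.closedBall c R ⊆ Metric.closedBall z s := by
  have hR := hs.trans hsR
  simp only [Set.subset_def, Set.mem_inter_iff, Metric.mem_closedBall, dist_pi_le_iff hs,
    dist_pi_le_iff hR, dist_pi_le_iff (sub_nonneg.2 hsR), Real.dist_eq, abs_le] at hx ⊢
  refine ⟨fun i => max (c i - (R - s)) (min (c i + (R - s)) (x i)), fun i => ?_, fun i => ?_,
    fun y hy i => ?_⟩
  · have := hx i
    grind
  · have := hx i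
    grind
  · have := hx i
    have := hy.1 i
    have := hy.2 i
    grind

/-- The average of the positive part of `g` over `Q`. -/
noncomputable def cubeAvg {n : ℕ} (Q : Set (Fin n → ℝ)) (g : (Fin n → ℝ) → ℝ) : ℝ≥0∞ :=
  (volume Q)⁻¹ * ∫⁻ x in Q, ENNReal.ofReal (g x)

lemma volume_closedBall_pos_lt_top {n : ℕ} (c : Fin n → ℝ) {R : ℝ} (hR : 0 < R) :
    volume (Metric.closedBall c R) ≠ 0 ∧ volume (Metric.closedBall c R) ≠ ∞ :=
  ⟨(Metric.measure_closedBall_pos volume c hR).ne', measure_closedBall_lt_top.ne⟩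

lemma ae_exists_stopping_closedBall {n : ℕ} {c : Fin n → ℝ} {R : ℝ} (hR : 0 < R)
    {w : (Fin n → ℝ) → ℝ} (hw : Measurable w)
    (hfin : ∫⁻ x in Metric.closedBall c R, ENNReal.ofReal (w x) ≠ ∞)
    {L : ℝ≥0∞} (hL : cubeAvg (Metric.closedBall c R) w ≤ L) :
    ∀ᵐ x, x ∈ Metric.closedBall c R → L < ENNReal.ofReal (w x) →
      ∃ (y z : Fin n → ℝ) (s : ℝ), 0 < s ∧ s ≤ R ∧ Metric.closedBall y s ⊆ Metric.closedBall c R ∧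
        L < cubeAvg (Metric.closedBall y s) w ∧
        Metric.closedBall y (5 * s) ∩ Metric.closedBall c R ⊆ Metric.closedBall z (8 * s) ∧
        cubeAvg (Metric.closedBall z (8 * s)) w ≤ L ∧ x ∈ Metric.closedBall y s := by
  set Q := Metric.closedBall c R with hQ
  have hQm : MeasurableSet Q := Metric.isClosed_closedBall.measurableSet
  have hf : Measurable (Q.indicator fun x => ENNReal.ofReal (w x)) :=
    hw.ennreal_ofReal.indicator hQm
  filter_upwards [(IsUnifLocDoublingMeasure.vitaliFamily volume 1).ae_tendsto_lintegral_div'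
    hf (by rwa [lintegral_indicator hQm])] with x hx hxQ hxL
  have hs : ∀ k : ℕ, 0 < R / 8 ^ k ∧ R / 8 ^ k ≤ R := fun k =>
    ⟨by positivity, div_le_self hR.le (one_le_pow₀ (by norm_num))⟩
  choose z hzc hxz hz using fun k : ℕ =>
    exists_closedBall_inter_subset hxQ (hs k).1.le (hs k).2
  have hzQ : ∀ k, Metric.closedBall (z k) (R / 8 ^ k) ⊆ Q := fun k =>
    Metric.closedBall_subset_closedBall' (by linarith [hzc k])
  have hlim : Filter.Tendsto (fun k : ℕ => R / 8 ^ k) Filter.atTop (nhdsWithin 0 (Set.Ioi 0)) := by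
    refine tendsto_nhdsWithin_iff.2 ⟨?_, Filter.Eventually.of_forall fun k => (hs k).1⟩
    have := (tendsto_pow_atTop_nhds_zero_of_lt_one (r := (8 : ℝ)⁻¹) (by norm_num)
      (by norm_num)).const_mul R
    simpa [div_eq_mul_inv] using this
  have htend := hx.comp (IsUnifLocDoublingMeasure.tendsto_closedBall_filterAt volume z _ hlim
    (Filter.Eventually.of_forall fun k => by rw [one_mul]; exact hxz k))
  rw [Set.indicator_of_mem hxQ] at htend
  have hex : ∃ k, L < cubeAvg (Metric.closedBall (z k) (R / 8 ^ k)) w := by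
    obtain ⟨k, hk⟩ := (htend.eventually (lt_mem_nhds hxL)).exists
    refine ⟨k, ?_⟩
    simp only [Function.comp_apply] at hk
    rw [setLIntegral_indicator hQm, Set.inter_eq_right.2 (hzQ k), ENNReal.div_eq_inv_mul] at hk
    exact hk
  classical
  obtain ⟨k, hk⟩ : ∃ k, Nat.find hex = k + 1 := by
    refine Nat.exists_eq_succ_of_ne_zero fun h0 => ?_
    have h1 := Nat.find_spec hex
    rw [h0] at h1
    have h2 : Metric.closedBall (z 0) (R / 8 ^ 0) = Q := by
      have h3 := hzc 0
      rw [pow_zero, div_one, sub_self, dist_le_zero] at h3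
      rw [h3, pow_zero, div_one]
    rw [h2] at h1
    exact h1.not_ge hL
  have hspec := Nat.find_spec hex
  have hmin := Nat.find_min hex (m := k) (by omega)
  rw [hk] at hspec
  have h8 : R / 8 ^ k = 8 * (R / 8 ^ (k + 1)) := by rw [pow_succ]; field_simp
  refine ⟨z (k + 1), z k, R / 8 ^ (k + 1), (hs _).1, (hs _).2, hzQ _, hspec, ?_, ?_, hxz _⟩
  · rw [← h8]
    refine fun y hy => hz k ⟨?_, hy.2⟩
    have h1 := hy.1
    have h2 := hxz (k + 1)
    have h3 := (hs (k + 1)).1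
    rw [Metric.mem_closedBall] at h1 h2 ⊢
    rw [h8]
    have := dist_triangle_right y x (z (k + 1))
    linarith
  · rw [← h8]
    exact not_lt.1 hmin

lemma setLIntegral_superlevel_le {n : ℕ} {c : Fin n → ℝ} {R : ℝ} (hR : 0 < R)
    {w : (Fin n → ℝ) → ℝ} (hw : Measurable w) {β lam : ℝ} (hlam : 0 ≤ lam)
    (hfin : ∫⁻ x in Metric.closedBall c R, ENNReal.ofReal (w x) ≠ ∞)
    (hL : cubeAvg (Metric.closedBall c R) w ≤ ENNReal.ofReal lam)
    (hhalf : ∀ (y : Fin n → ℝ) (s : ℝ), 0 < s → Metric.closedBall y s ⊆ Metric.closedBall c R →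
      ENNReal.ofReal lam < cubeAvg (Metric.closedBall y s) w →
      volume (Metric.closedBall y s) ≤
        2 * volume (Metric.closedBall y s ∩ {x | β * lam < w x})) :
    ∫⁻ x in Metric.closedBall c R ∩ {x | lam < w x}, ENNReal.ofReal (w x) ≤
      ENNReal.ofReal lam * (8 ^ n * 2) *
        volume (Metric.closedBall c R ∩ {x | β * lam < w x}) := by
  set Q := Metric.closedBall c R with hQ
  have hQm : MeasurableSet Q := Metric.isClosed_closedBall.measurableSet
  have hae := ae_exists_stopping_closedBall hR hw hfin hL
  set G : Set (Fin n → ℝ) := {x | ∃ (y z : Fin n → ℝ) (s : ℝ), 0 < s ∧ s ≤ R ∧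
    Metric.closedBall y s ⊆ Q ∧ ENNReal.ofReal lam < cubeAvg (Metric.closedBall y s) w ∧
    Metric.closedBall y (5 * s) ∩ Q ⊆ Metric.closedBall z (8 * s) ∧
    cubeAvg (Metric.closedBall z (8 * s)) w ≤ ENNReal.ofReal lam ∧
    x ∈ Metric.closedBall y s} with hG
  choose! y z s hs0 hsR hyQ hyL hyz hzL hxy using fun x (hx : x ∈ G) => hx
  obtain ⟨u, huG, hdisj, hcov⟩ := Vitali.exists_disjoint_subfamily_covering_enlargement_closedBall
    G y s R hsR 5 (by norm_num)
  have hucount : u.Countable := hdisj.countable_of_nonempty_interior fun x hx =>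
    (Metric.nonempty_ball.2 (hs0 _ (huG hx))).mono Metric.ball_subset_interior_closedBall
  set ν := volume.withDensity fun x => ENNReal.ofReal (w x) with hν
  have hwlt : ∀ t : ℝ, MeasurableSet {x | t < w x} := fun t => measurableSet_lt measurable_const hw
  calc ∫⁻ x in Q ∩ {x | lam < w x}, ENNReal.ofReal (w x)
      = ν (Q ∩ {x | lam < w x}) := (withDensity_apply _ (hQm.inter (hwlt lam))).symm
    _ ≤ ν (⋃ b ∈ u, Metric.closedBall (z b) (8 * s b)) := by
        refine measure_mono_ae ?_
        filter_upwards [(withDensity_absolutelyContinuous volume _).ae_le hae] with x hx hxQ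
        have hxL : ENNReal.ofReal lam < ENNReal.ofReal (w x) :=
          (ENNReal.ofReal_lt_ofReal_iff (hlam.trans_lt hxQ.2)).2 hxQ.2
        have hxG : x ∈ G := hx hxQ.1 hxL
        obtain ⟨b, hb, hsub⟩ := hcov x hxG
        exact Set.mem_biUnion hb (hyz b (huG hb) ⟨hsub (hxy x hxG), hxQ.1⟩)
    _ ≤ ∑' b : u, ν (Metric.closedBall (z b) (8 * s b)) := measure_biUnion_le _ hucount _
    _ ≤ ∑' b : u, ENNReal.ofReal lam * (8 ^ n * 2) *
          volume (Metric.closedBall (y b) (s b) ∩ {x | β * lam < w x}) := by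
        refine ENNReal.tsum_le_tsum fun b => ?_
        have hb := huG b.2
        have h0 := hs0 _ hb
        have h1 := hzL _ hb
        obtain ⟨v0, vt⟩ := volume_closedBall_pos_lt_top (z b) (by positivity : 0 < 8 * s b)
        rw [cubeAvg, ENNReal.inv_mul_le_iff v0 vt] at h1
        rw [hν, withDensity_apply _ Metric.isClosed_closedBall.measurableSet]
        have h2 : volume (Metric.closedBall (z b) (8 * s b)) =
            8 ^ n * volume (Metric.closedBall (y b) (s b)) := by
          rw [Real.volume_pi_closedBall _ (by positivity), Real.volume_pi_closedBall _ h0.le,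
            ← ENNReal.ofReal_ofNat, ← ENNReal.ofReal_pow (by norm_num),
            ← ENNReal.ofReal_mul (by positivity), Fintype.card_fin, ← mul_pow]
          ring_nf
        calc _ ≤ _ := h1
          _ = ENNReal.ofReal lam * 8 ^ n * volume (Metric.closedBall (y b) (s b)) := by
            rw [h2]; ring
          _ ≤ ENNReal.ofReal lam * 8 ^ n *
              (2 * volume (Metric.closedBall (y b) (s b) ∩ {x | β * lam < w x})) := by
            gcongr
            exact hhalf _ _ h0 (hyQ _ hb) (hyL _ hb)
          _ = _ := by ring
    _ = ENNReal.ofReal lam * (8 ^ n * 2) *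
          volume (⋃ b ∈ u, Metric.closedBall (y b) (s b) ∩ {x | β * lam < w x}) := by
        rw [ENNReal.tsum_mul_left, measure_biUnion hucount]
        · exact hdisj.mono fun b => Set.inter_subset_left
        · exact fun b _ => Metric.isClosed_closedBall.measurableSet.inter (hwlt _)
    _ ≤ _ := by
        gcongr
        exact Set.iUnion₂_subset fun b hb => Set.inter_subset_inter_left _ (hyQ _ (huG hb))
lemma isCube_iff {n : ℕ} {Q : Set (Fin n → ℝ)} :
    IsCube Q ↔ ∃ (c : Fin n → ℝ) (R : ℝ), 0 < R ∧ Q = Metric.closedBall c R := by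
  constructor
  · rintro ⟨a, l, hl, rfl⟩
    refine ⟨fun i => a i + l / 2, l / 2, by positivity, ?_⟩
    rw [closedBall_pi _ (by positivity)]
    simp only [Real.closedBall_eq_Icc, add_sub_cancel_right, add_assoc, add_halves]
  · rintro ⟨c, R, hR, rfl⟩
    refine ⟨fun i => c i - R, 2 * R, by positivity, ?_⟩
    rw [closedBall_pi _ hR.le]
    simp only [Real.closedBall_eq_Icc, sub_add_eq_add_sub, two_mul, ← add_assoc,
      add_sub_cancel_right]

lemma measure_le_two_mul_superlevel {n : ℕ} {B : Set (Fin n → ℝ)} (hB0 : volume B ≠ 0)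
    (hBt : volume B ≠ ∞) {w : (Fin n → ℝ) → ℝ} (hw : Measurable w)
    (hpos : ∀ᵐ x ∂volume.restrict B, 0 < w x) {δ β lam : ℝ} (hδ : 0 < δ) (hβ : 0 < β)
    (hlam : 0 < lam) {C : ℝ≥0∞} (hβC : (ENNReal.ofReal β * C) ^ δ ≤ 2⁻¹)
    (hC : cubeAvg B w * cubeAvg B (fun x => w x ^ (-δ)) ^ (1 / δ) ≤ C)
    (hL : ENNReal.ofReal lam < cubeAvg B w) :
    volume B ≤ 2 * volume (B ∩ {x | β * lam < w x}) := by
  set m := (volume B)⁻¹ * volume (B \ {x | β * lam < w x}) with hm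
  have hSm : MeasurableSet {x | β * lam < w x} := measurableSet_lt measurable_const hw
  have hcheb : ENNReal.ofReal ((β * lam) ^ (-δ)) * m ≤ cubeAvg B fun x => w x ^ (-δ) := by
    rw [hm, cubeAvg, mul_left_comm]
    gcongr
    rw [Set.sdiff_eq, Set.inter_comm, ← Measure.restrict_apply hSm.compl, ← setLIntegral_const]
    refine (setLIntegral_mono_ae' hSm.compl ?_).trans (setLIntegral_le_lintegral _ _)
    filter_upwards [hpos] with x hx hxS
    exact ENNReal.ofReal_le_ofReal (Real.rpow_le_rpow_of_nonpos hx (not_lt.1 hxS) (by linarith))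
  clear_value m
  have hm1 : ENNReal.ofReal β⁻¹ * m ^ (1 / δ) ≤ C := by
    calc ENNReal.ofReal β⁻¹ * m ^ (1 / δ)
        = ENNReal.ofReal lam * (ENNReal.ofReal ((β * lam) ^ (-δ)) * m) ^ (1 / δ) := by
          rw [ENNReal.mul_rpow_of_nonneg _ _ (by positivity),
            ENNReal.ofReal_rpow_of_pos (by positivity), ← Real.rpow_mul (by positivity),
            ← mul_assoc, ← ENNReal.ofReal_mul hlam.le]
          congr 2
          rw [show -δ * (1 / δ) = -1 by field_simp, Real.rpow_neg_one]
          field_simp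
      _ ≤ cubeAvg B w * cubeAvg B (fun x => w x ^ (-δ)) ^ (1 / δ) := by gcongr
      _ ≤ C := hC
  have hm2 : m ≤ 2⁻¹ := by
    refine le_trans ?_ hβC
    have h1 : m ^ (1 / δ) ≤ ENNReal.ofReal β * C := by
      calc m ^ (1 / δ) = ENNReal.ofReal β * (ENNReal.ofReal β⁻¹ * m ^ (1 / δ)) := by
            rw [← mul_assoc, ← ENNReal.ofReal_mul hβ.le, mul_inv_cancel₀ hβ.ne', ENNReal.ofReal_one,
              one_mul]
        _ ≤ _ := by gcongr
    calc m = (m ^ (1 / δ)) ^ δ := by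
          rw [← ENNReal.rpow_mul, one_div_mul_cancel hδ.ne', ENNReal.rpow_one]
      _ ≤ _ := by gcongr
  rw [hm, ENNReal.inv_mul_le_iff hB0 hBt] at hm2
  have hsum := measure_inter_add_sdiff (μ := volume) B hSm
  have hhalf : 2⁻¹ * volume B + 2⁻¹ * volume B = volume B := by
    rw [← add_mul, ENNReal.inv_two_add_inv_two, one_mul]
  have h3 : 2⁻¹ * volume B ≤ volume (B ∩ {x | β * lam < w x}) := by
    refine (ENNReal.add_le_add_iff_right (a := 2⁻¹ * volume B)
      (ENNReal.mul_ne_top (by simp) hBt)).1 ?_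
    rw [hhalf]
    nth_rewrite 1 [← hsum]
    rw [mul_comm _ (volume B)]
    gcongr
  calc volume B = 2 * (2⁻¹ * volume B) := by rw [two_mul, hhalf]
    _ ≤ _ := by gcongr

lemma lintegral_rpow_le_of_forall_min {α : Type*} [MeasurableSpace α] {μ : Measure α}
    {w : α → ℝ} (hw : Measurable w) (hpos : 0 ≤ᵐ[μ] w) {q : ℝ} (hq : 0 ≤ q) {K : ℝ≥0∞}
    (h : ∀ N : ℕ, ∫⁻ x, ENNReal.ofReal (min (w x) N ^ q) ∂μ ≤ K) :
    ∫⁻ x, ENNReal.ofReal (w x ^ q) ∂μ ≤ K := by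
  refine le_of_tendsto' (lintegral_tendsto_of_tendsto_of_monotone
    (fun N : ℕ => ((hw.min measurable_const).pow_const q).ennreal_ofReal.aemeasurable) ?_ ?_) h
  · filter_upwards [hpos] with x hx
    intro M N hMN
    have hx' : 0 ≤ w x := hx
    dsimp only
    gcongr
  · refine Filter.Eventually.of_forall fun x => tendsto_const_nhds.congr' ?_
    obtain ⟨N, hN⟩ := exists_nat_ge (w x)
    filter_upwards [Filter.eventually_ge_atTop N] with M hM
    rw [min_eq_left (hN.trans (by exact_mod_cast hM))]

lemma exists_reverse_holder {n : ℕ} {Ω : Set (Fin n → ℝ)} {w : (Fin n → ℝ) → ℝ}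
    (hw : Measurable w) (hpos : ∀ᵐ x ∂volume.restrict Ω, 0 < w x)
    (hint : ∀ Q, IsCube Q → Q ⊆ Ω → ∫⁻ x in Q, ENNReal.ofReal (w x) ≠ ∞)
    {δ : ℝ} (hδ : 0 < δ) {C : ℝ≥0∞} (hC : C ≠ ∞)
    (hA : ∀ Q, IsCube Q → Q ⊆ Ω →
      cubeAvg Q w * cubeAvg Q (fun x => w x ^ (-δ)) ^ (1 / δ) ≤ C) :
    ∃ ε₀ : ℝ, 0 < ε₀ ∧ ∀ ε, 0 < ε → ε ≤ ε₀ → ∀ Q, IsCube Q → Q ⊆ Ω →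
      cubeAvg Q (fun x => w x ^ (1 + ε)) ≤ 2 * cubeAvg Q w ^ (1 + ε) := by
  obtain ⟨β, hβ, hβ1, hβC⟩ : ∃ β : ℝ, 0 < β ∧ β ≤ 1 ∧ (ENNReal.ofReal β * C) ^ δ ≤ 2⁻¹ := by
    have h2 : (0 : ℝ) < 2⁻¹ ^ (1 / δ) := by positivity
    have h3 : (2⁻¹ : ℝ) ^ (1 / δ) ≤ 1 := Real.rpow_le_one (by norm_num) (by norm_num) (by positivity)
    have hc := C.toReal_nonneg
    refine ⟨2⁻¹ ^ (1 / δ) / (C.toReal + 1), by positivity, ?_, ?_⟩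
    · rw [div_le_one (by positivity)]
      linarith
    · rw [← ENNReal.ofReal_toReal hC, ENNReal.toReal_ofReal hc, ← ENNReal.ofReal_mul (by positivity),
        ENNReal.ofReal_rpow_of_nonneg (by positivity) hδ.le, ← ENNReal.ofReal_ofNat 2,
        ← ENNReal.ofReal_inv_of_pos two_pos]
      refine ENNReal.ofReal_le_ofReal ?_
      calc _ ≤ ((2⁻¹ : ℝ) ^ (1 / δ)) ^ δ := by
            gcongr
            rw [div_mul_eq_mul_div, div_le_iff₀ (by positivity)]
            nlinarith
        _ = 2⁻¹ := by
          rw [← Real.rpow_mul (by norm_num), one_div_mul_cancel hδ.ne', Real.rpow_one]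
  set A : ℝ := 8 ^ n * 2 with hAdef
  have hA0 : 0 < A := by positivity
  refine ⟨min 1 (β ^ 2 / 2 / A), by positivity, fun ε hε hε0 Q hQ hQΩ => ?_⟩
  obtain ⟨c, R, hR, rfl⟩ := isCube_iff.1 hQ
  have hsmall : ε * A ≤ β ^ (1 + ε) / 2 := by
    have h1 := hε0.trans (min_le_right _ _)
    rw [le_div_iff₀ hA0] at h1
    refine h1.trans ?_
    have h2 : β ^ (2 : ℝ) ≤ β ^ (1 + ε) :=
      Real.rpow_le_rpow_of_exponent_ge hβ hβ1 (by linarith [hε0.trans (min_le_left _ _)])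
    rw [Real.rpow_two] at h2
    linarith
  have hfin := hint _ hQ hQΩ
  obtain ⟨v0, vt⟩ := volume_closedBall_pos_lt_top c hR
  have havg : cubeAvg (Metric.closedBall c R) w ≠ ∞ :=
    ENNReal.mul_ne_top (ENNReal.inv_ne_top.2 v0) hfin
  set a := (cubeAvg (Metric.closedBall c R) w).toReal with ha
  have haeq : cubeAvg (Metric.closedBall c R) w = ENNReal.ofReal a :=
    (ENNReal.ofReal_toReal havg).symm
  have ha0 : 0 ≤ a := ENNReal.toReal_nonneg
  have hposQ := ae_restrict_of_ae_restrict_of_subset hQΩ hpos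
  have hsup : ∀ t, 0 < t → a ≤ t → ∫⁻ x in {x | t < w x}, ENNReal.ofReal (w x)
      ∂volume.restrict (Metric.closedBall c R) ≤
      ENNReal.ofReal (A * t) * volume.restrict (Metric.closedBall c R) {x | β * t < w x} := by
    intro t ht hat
    have hm : ∀ t : ℝ, MeasurableSet {x | t < w x} := fun t => measurableSet_lt measurable_const hw
    have hmain := setLIntegral_superlevel_le (β := β) hR hw ht.le hfin
      (haeq.trans_le (ENNReal.ofReal_le_ofReal hat)) fun y s hs hsub hL => by
        obtain ⟨v0', vt'⟩ := volume_closedBall_pos_lt_top y hs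
        have hcube : IsCube (Metric.closedBall y s) := isCube_iff.2 ⟨y, s, hs, rfl⟩
        exact measure_le_two_mul_superlevel v0' vt' hw
          (ae_restrict_of_ae_restrict_of_subset hsub hposQ) hδ hβ ht hβC
          (hA _ hcube (hsub.trans hQΩ)) hL
    rw [Measure.restrict_restrict (hm t), Measure.restrict_apply (hm _), Set.inter_comm,
      Set.inter_comm _ (Metric.closedBall c R), mul_comm A, ENNReal.ofReal_mul ht.le, hAdef,
      ENNReal.ofReal_mul (by positivity), ENNReal.ofReal_pow (by positivity),
      ENNReal.ofReal_ofNat, ENNReal.ofReal_ofNat]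
    exact hmain
  have hbound : ∫⁻ x in Metric.closedBall c R, ENNReal.ofReal (w x ^ (1 + ε)) ≤
      2 * (ENNReal.ofReal (a ^ ε) * ∫⁻ x in Metric.closedBall c R, ENNReal.ofReal (w x)) := by
    refine lintegral_rpow_le_of_forall_min hw (hposQ.mono fun x hx => hx.le) (by positivity)
      fun N => ?_
    have hg0 : 0 ≤ᵐ[volume.restrict (Metric.closedBall c R)] fun x => min (w x) N := by
      filter_upwards [hposQ] with x hx using le_min hx.le N.cast_nonneg
    refine (lintegral_rpow_one_add_le_of_distribution _ (hw.min measurable_const) hg0 hA0.le ha0 hβ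
      hε hsmall ?_ fun t ht hat => ?_).trans ?_
    · refine ne_top_of_le_ne_top ?_ (lintegral_mono_ae (g := fun _ => ENNReal.ofReal
        ((N : ℝ) ^ (1 + ε))) ?_)
      · rw [lintegral_const, Measure.restrict_apply_univ]
        exact ENNReal.mul_ne_top ofReal_ne_top vt
      · filter_upwards [hg0] with x hx
        exact ENNReal.ofReal_le_ofReal (Real.rpow_le_rpow hx (min_le_right _ _) (by positivity))
    · rcases lt_or_ge t N with htN | htN
      · have hβt : β * t < N := (mul_le_of_le_one_left ht.le hβ1).trans_lt htN
        simp only [lt_min_iff, htN, hβt, and_true]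
        refine le_trans ?_ (hsup t ht hat)
        gcongr
        exact min_le_left _ _
      · simp [htN.not_gt]
    · gcongr
      exact min_le_left _ _
  calc cubeAvg (Metric.closedBall c R) (fun x => w x ^ (1 + ε))
      ≤ (volume (Metric.closedBall c R))⁻¹ * (2 * (ENNReal.ofReal (a ^ ε) *
          ∫⁻ x in Metric.closedBall c R, ENNReal.ofReal (w x))) := by
        rw [cubeAvg]
        gcongr
    _ = 2 * (ENNReal.ofReal (a ^ ε) * cubeAvg (Metric.closedBall c R) w) := by
        rw [cubeAvg]
        ring
    _ = _ := by
        rw [haeq, ENNReal.ofReal_rpow_of_nonneg ha0 (by positivity),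
          ← ENNReal.ofReal_mul (by positivity), add_comm, Real.rpow_add_one' ha0 (by positivity)]

section Muckenhoupt

variable {n : ℕ} {Ω Q : Set (Fin n → ℝ)} {w : (Fin n → ℝ) → ℝ}

lemma IsCube.volume_ne_zero (hQ : IsCube Q) : volume Q ≠ 0 := by
  obtain ⟨c, R, hR, rfl⟩ := isCube_iff.1 hQ
  exact (volume_closedBall_pos_lt_top c hR).1

lemma IsCube.volume_ne_top (hQ : IsCube Q) : volume Q ≠ ∞ := by
  obtain ⟨c, R, hR, rfl⟩ := isCube_iff.1 hQ
  exact (volume_closedBall_pos_lt_top c hR).2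

lemma cubeAvg_congr_of_pos (hpos : ∀ᵐ x ∂volume.restrict Ω, 0 < w x) (hQΩ : Q ⊆ Ω)
    {f g : (Fin n → ℝ) → ℝ} (h : ∀ x, 0 < w x → f x = g x) : cubeAvg Q f = cubeAvg Q g := by
  rw [cubeAvg, cubeAvg]
  congr 1
  refine lintegral_congr_ae ?_
  filter_upwards [ae_restrict_of_ae_restrict_of_subset hQΩ hpos] with x hx
  rw [h x hx]

/-- Jensen's inequality for a concave power. -/
lemma cubeAvg_rpow_le (hw : Measurable w) (hpos : ∀ᵐ x ∂volume.restrict Ω, 0 < w x)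
    (hQ : IsCube Q) (hQΩ : Q ⊆ Ω) {θ : ℝ} (hθ : 0 < θ) (hθ1 : θ ≤ 1) :
    cubeAvg Q (fun x => w x ^ θ) ≤ cubeAvg Q w ^ θ := by
  have : IsProbabilityMeasure ((volume Q)⁻¹ • volume.restrict Q) :=
    ⟨by simp [ENNReal.inv_mul_cancel hQ.volume_ne_zero hQ.volume_ne_top]⟩
  have h := eLpNorm'_le_eLpNorm'_of_exponent_le hθ hθ1 ((volume Q)⁻¹ • volume.restrict Q)
    (hw.ennreal_ofReal).aestronglyMeasurable
  simp only [eLpNorm', enorm_eq_self, lintegral_smul_measure, smul_eq_mul, ENNReal.rpow_one,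
    div_one] at h
  have e : cubeAvg Q (fun x => w x ^ θ) =
      (volume Q)⁻¹ * ∫⁻ x in Q, ENNReal.ofReal (w x) ^ θ := by
    rw [cubeAvg]
    congr 1
    refine lintegral_congr_ae ?_
    filter_upwards [ae_restrict_of_ae_restrict_of_subset hQΩ hpos] with x hx
    rw [ENNReal.ofReal_rpow_of_pos hx]
  rw [e]
  calc _ = (((volume Q)⁻¹ * ∫⁻ x in Q, ENNReal.ofReal (w x) ^ θ) ^ (1 / θ)) ^ θ := by
        rw [← ENNReal.rpow_mul, one_div_mul_cancel hθ.ne', ENNReal.rpow_one]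
    _ ≤ _ := by
        gcongr
        exact h

lemma cubeAvg_ne_top_iff (hQ : IsCube Q) :
    cubeAvg Q w ≠ ∞ ↔ ∫⁻ x in Q, ENNReal.ofReal (w x) ≠ ∞ := by
  refine ⟨fun h h' => h ?_, fun h => ENNReal.mul_ne_top (ENNReal.inv_ne_top.2 hQ.volume_ne_zero) h⟩
  rw [cubeAvg, h', ENNReal.mul_top (ENNReal.inv_ne_zero.2 hQ.volume_ne_top)]

lemma cubeAvg_ne_zero (hw : Measurable w) (hpos : ∀ᵐ x ∂volume.restrict Ω, 0 < w x)
    (hQ : IsCube Q) (hQΩ : Q ⊆ Ω) : cubeAvg Q w ≠ 0 := by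
  refine mul_ne_zero (ENNReal.inv_ne_zero.2 hQ.volume_ne_top) fun h => hQ.volume_ne_zero ?_
  rw [lintegral_eq_zero_iff hw.ennreal_ofReal] at h
  rw [← Measure.restrict_eq_zero, ← ae_eq_bot, ← Filter.eventually_false_iff_eq_bot]
  filter_upwards [h, ae_restrict_of_ae_restrict_of_subset hQΩ hpos] with x hx hx'
  exact (ENNReal.ofReal_pos.2 hx').ne' hx

lemma IsWeight.cubeAvg_ne_top (hw : IsWeight Ω w) (hQ : IsCube Q) (hQΩ : Q ⊆ Ω) :
    cubeAvg Q w ≠ ∞ :=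
  (cubeAvg_ne_top_iff hQ).2 (hw.locInt Q hQ hQΩ).lintegral_lt_top.ne

lemma IsWeight.rpow (hw : IsWeight Ω w) {θ : ℝ}
    (h : ∀ Q, IsCube Q → Q ⊆ Ω → cubeAvg Q (fun x => w x ^ θ) ≠ ∞) :
    IsWeight Ω fun x => w x ^ θ where
  measurable := hw.measurable.pow_const θ
  pos := hw.pos.mono fun _ hx => Real.rpow_pos_of_pos hx θ
  locInt Q hQ hQΩ := by
    refine (lintegral_ofReal_ne_top_iff_integrable
      (hw.measurable.pow_const θ).aestronglyMeasurable ?_).1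
      ((cubeAvg_ne_top_iff hQ).1 (h Q hQ hQΩ))
    filter_upwards [ae_restrict_of_ae_restrict_of_subset hQΩ hw.pos] with x hx
    exact (Real.rpow_pos_of_pos hx θ).le

lemma IsWeight.rpow_of_le_one (hw : IsWeight Ω w) {θ : ℝ} (hθ : 0 < θ) (hθ1 : θ ≤ 1) :
    IsWeight Ω fun x => w x ^ θ :=
  hw.rpow fun _ hQ hQΩ => ne_top_of_le_ne_top
    (ENNReal.rpow_ne_top_of_nonneg hθ.le (hw.cubeAvg_ne_top hQ hQΩ))
    (cubeAvg_rpow_le hw.measurable hw.pos hQ hQΩ hθ hθ1)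

/-- The `A_p` condition in terms of `δ = 1 / (p - 1)`. -/
def ApCond (Ω : Set (Fin n → ℝ)) (δ : ℝ) (w : (Fin n → ℝ) → ℝ) : Prop :=
  ∃ C : ℝ≥0∞, C ≠ ∞ ∧ ∀ Q, IsCube Q → Q ⊆ Ω →
    cubeAvg Q w * cubeAvg Q (fun x => w x ^ (-δ)) ^ (1 / δ) ≤ C

lemma memApGT1_iff {p : ℝ} (hp : 1 < p) :
    MemApGT1 Ω p w ↔ IsWeight Ω w ∧ ApCond Ω (1 / (p - 1)) w := by
  have h1 : p - 1 ≠ 0 := by linarith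
  have h2 : 1 - p / (p - 1) = -(1 / (p - 1)) := by field_simp; ring
  simp only [MemApGT1, ApCond, cubeAvg, h2, one_div_one_div]

lemma memA1_iff : MemA1 Ω w ↔ IsWeight Ω w ∧ ∃ C : ℝ≥0∞, C ≠ ∞ ∧
    ∀ᵐ x ∂volume.restrict Ω, ∀ Q, IsCube Q → Q ⊆ Ω → x ∈ Q →
      cubeAvg Q w ≤ C * ENNReal.ofReal (w x) := by
  refine and_congr_right fun hw => ?_
  have habs : ∀ Q, Q ⊆ Ω → (volume Q)⁻¹ * ∫⁻ y in Q, ENNReal.ofReal |w y| = cubeAvg Q w :=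
    fun Q hQΩ => cubeAvg_congr_of_pos hw.pos hQΩ fun x hx => abs_of_pos hx
  constructor
  · rintro ⟨C, hC⟩
    refine ⟨ENNReal.ofReal C, ofReal_ne_top, ?_⟩
    filter_upwards [hC, hw.pos] with x hx hwx Q hQ hQΩ hxQ
    rw [← ENNReal.ofReal_mul' hwx.le, ← habs Q hQΩ]
    refine le_trans ?_ hx
    refine le_iSup_of_le Q (le_iSup_of_le hQ (le_iSup_of_le hQΩ ?_))
    exact le_iSup_of_le (i := hxQ) le_rfl
  · rintro ⟨C, hC, h⟩
    refine ⟨C.toReal, ?_⟩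
    filter_upwards [h] with x hx
    rw [ENNReal.ofReal_mul ENNReal.toReal_nonneg, ENNReal.ofReal_toReal hC]
    refine iSup₂_le fun Q hQ => iSup₂_le fun hQΩ hxQ => ?_
    rw [habs Q hQΩ]
    exact hx Q hQ hQΩ hxQ

lemma MemA1.apCond (h : MemA1 Ω w) {δ : ℝ} (hδ : 0 < δ) : ApCond Ω δ w := by
  obtain ⟨hw, C, hC, h⟩ := memA1_iff.1 h
  refine ⟨ENNReal.ofReal (C.toReal + 1), ofReal_ne_top, fun Q hQ hQΩ => ?_⟩
  have hc := C.toReal_nonneg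
  set c := C.toReal
  set b := (cubeAvg Q w).toReal
  have hb : cubeAvg Q w = ENNReal.ofReal b :=
    (ENNReal.ofReal_toReal (hw.cubeAvg_ne_top hQ hQΩ)).symm
  have hb0 : 0 < b :=
    ENNReal.toReal_pos (cubeAvg_ne_zero hw.measurable hw.pos hQ hQΩ) (hw.cubeAvg_ne_top hQ hQΩ)
  have hQm : MeasurableSet Q := by
    obtain ⟨c, R, hR, rfl⟩ := isCube_iff.1 hQ
    exact Metric.isClosed_closedBall.measurableSet
  have hσ : cubeAvg Q (fun x => w x ^ (-δ)) ≤ ENNReal.ofReal ((b / (c + 1)) ^ (-δ)) := by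
    rw [cubeAvg, ENNReal.inv_mul_le_iff hQ.volume_ne_zero hQ.volume_ne_top, mul_comm,
      ← setLIntegral_const]
    refine lintegral_mono_ae ?_
    filter_upwards [ae_restrict_of_ae_restrict_of_subset hQΩ h,
      ae_restrict_of_ae_restrict_of_subset hQΩ hw.pos, ae_restrict_mem hQm] with x hx hwx hxQ
    refine ENNReal.ofReal_le_ofReal (Real.rpow_le_rpow_of_nonpos (by positivity) ?_ (by linarith))
    have h1 := hx Q hQ hQΩ hxQ
    rw [hb, ← ENNReal.ofReal_toReal hC, ← ENNReal.ofReal_mul hc,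
      ENNReal.ofReal_le_ofReal_iff (by positivity)] at h1
    rw [div_le_iff₀ (by positivity)]
    have h2 : b ≤ c * w x := h1
    linarith
  calc _ ≤ ENNReal.ofReal b * ENNReal.ofReal ((b / (c + 1)) ^ (-δ)) ^ (1 / δ) := by
        rw [hb]
        gcongr
    _ = ENNReal.ofReal (c + 1) := by
        rw [ENNReal.ofReal_rpow_of_pos (by positivity), ← Real.rpow_mul (by positivity),
          show -δ * (1 / δ) = -1 by field_simp, Real.rpow_neg_one, ← ENNReal.ofReal_mul hb0.le]
        congr 1
        field_simp

lemma MemA1.rpow_of_avg_le (h : MemA1 Ω w) {θ : ℝ} (hθ : 0 < θ) {K : ℝ≥0∞} (hK : K ≠ ∞)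
    (hle : ∀ Q, IsCube Q → Q ⊆ Ω → cubeAvg Q (fun x => w x ^ θ) ≤ K * cubeAvg Q w ^ θ) :
    MemA1 Ω fun x => w x ^ θ := by
  obtain ⟨hw, C, hC, h⟩ := memA1_iff.1 h
  refine memA1_iff.2 ⟨hw.rpow fun Q hQ hQΩ => ne_top_of_le_ne_top (ENNReal.mul_ne_top hK
    (ENNReal.rpow_ne_top_of_nonneg hθ.le (hw.cubeAvg_ne_top hQ hQΩ))) (hle Q hQ hQΩ),
    K * C ^ θ, ENNReal.mul_ne_top hK (ENNReal.rpow_ne_top_of_nonneg hθ.le hC), ?_⟩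
  filter_upwards [h, hw.pos] with x hx hwx Q hQ hQΩ hxQ
  calc _ ≤ K * cubeAvg Q w ^ θ := hle Q hQ hQΩ
    _ ≤ K * (C * ENNReal.ofReal (w x)) ^ θ := by
      gcongr
      exact hx Q hQ hQΩ hxQ
    _ = _ := by
      rw [ENNReal.mul_rpow_of_nonneg _ _ hθ.le, ENNReal.ofReal_rpow_of_pos hwx, mul_assoc]

lemma rpow_rpow_comm {a : ℝ} (ha : 0 < a) (s t : ℝ) : (a ^ s) ^ t = (a ^ t) ^ s := by
  rw [← Real.rpow_mul ha.le, mul_comm, Real.rpow_mul ha.le]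

lemma ApCond.rpow_of_avg_le {δ : ℝ} (hδ : 0 < δ) (h : ApCond Ω δ w)
    (hpos : ∀ᵐ x ∂volume.restrict Ω, 0 < w x) {θ : ℝ} (hθ : 0 < θ) {K : ℝ≥0∞} (hK : K ≠ ∞)
    (hle : ∀ Q, IsCube Q → Q ⊆ Ω → cubeAvg Q (fun x => w x ^ θ) ≤ K * cubeAvg Q w ^ θ)
    (hle' : ∀ Q, IsCube Q → Q ⊆ Ω → cubeAvg Q (fun x => (w x ^ (-δ)) ^ θ) ≤
      K * cubeAvg Q (fun x => w x ^ (-δ)) ^ θ) :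
    ApCond Ω δ fun x => w x ^ θ := by
  obtain ⟨C, hC, h⟩ := h
  have hδ' : 0 ≤ 1 / δ := by positivity
  refine ⟨K * K ^ (1 / δ) * C ^ θ, by finiteness, fun Q hQ hQΩ => ?_⟩
  rw [cubeAvg_congr_of_pos hpos hQΩ fun x hx => rpow_rpow_comm hx θ (-δ)]
  calc _ ≤ K * cubeAvg Q w ^ θ * (K * cubeAvg Q (fun x => w x ^ (-δ)) ^ θ) ^ (1 / δ) := by
        gcongr
        exacts [hle Q hQ hQΩ, hle' Q hQ hQΩ]
    _ = K * K ^ (1 / δ) * (cubeAvg Q w * cubeAvg Q (fun x => w x ^ (-δ)) ^ (1 / δ)) ^ θ := by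
        rw [ENNReal.mul_rpow_of_nonneg _ _ hδ', ENNReal.mul_rpow_of_nonneg _ _ hθ.le,
          ← ENNReal.rpow_mul, ← ENNReal.rpow_mul, mul_comm θ]
        ring
    _ ≤ _ := by
        gcongr
        exact h Q hQ hQΩ

lemma ApCond.of_le {δ δ' : ℝ} (h : ApCond Ω δ w) (hw : IsWeight Ω w) (hδ' : 0 < δ')
    (hle : δ' ≤ δ) : ApCond Ω δ' w := by
  obtain ⟨C, hC, h⟩ := h
  have hδ := hδ'.trans_le hle
  refine ⟨C, hC, fun Q hQ hQΩ => le_trans ?_ (h Q hQ hQΩ)⟩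
  gcongr
  have e : cubeAvg Q (fun x => w x ^ (-δ')) = cubeAvg Q fun x => (w x ^ (-δ)) ^ (δ' / δ) :=
    cubeAvg_congr_of_pos hw.pos hQΩ fun x hx => by
      rw [← Real.rpow_mul hx.le]
      congr 1
      field_simp
  rw [e]
  calc _ ≤ (cubeAvg Q (fun x => w x ^ (-δ)) ^ (δ' / δ)) ^ (1 / δ') := by
        gcongr
        exact cubeAvg_rpow_le (hw.measurable.pow_const _)
          (hw.pos.mono fun x hx => Real.rpow_pos_of_pos hx _) hQ hQΩ (by positivity)
          ((div_le_one hδ).2 hle)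
    _ = _ := by
        rw [← ENNReal.rpow_mul]
        congr 1
        field_simp

lemma ApCond.cubeAvg_rpow_neg_ne_top {δ : ℝ} (h : ApCond Ω δ w) (hw : IsWeight Ω w) (hδ : 0 < δ)
    (hQ : IsCube Q) (hQΩ : Q ⊆ Ω) : cubeAvg Q (fun x => w x ^ (-δ)) ≠ ∞ := by
  obtain ⟨C, hC, h⟩ := h
  intro htop
  have := h Q hQ hQΩ
  rw [htop, ENNReal.top_rpow_of_pos (by positivity),
    ENNReal.mul_top (cubeAvg_ne_zero hw.measurable hw.pos hQ hQΩ)] at this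
  exact hC (top_le_iff.1 this)

lemma ApCond.exists_reverse_holder {δ : ℝ} (h : ApCond Ω δ w) (hw : IsWeight Ω w) (hδ : 0 < δ) :
    ∃ ε₀ : ℝ, 0 < ε₀ ∧ ∀ ε, 0 < ε → ε ≤ ε₀ → ∀ Q, IsCube Q → Q ⊆ Ω →
      cubeAvg Q (fun x => w x ^ (1 + ε)) ≤ 2 * cubeAvg Q w ^ (1 + ε) := by
  obtain ⟨C, hC, h⟩ := h
  exact _root_.exists_reverse_holder hw.measurable hw.pos
    (fun Q hQ hQΩ => (cubeAvg_ne_top_iff hQ).1 (hw.cubeAvg_ne_top hQ hQΩ)) hδ hC h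

lemma ApCond.dual {δ : ℝ} (h : ApCond Ω δ w) (hw : IsWeight Ω w) (hδ : 0 < δ) :
    ApCond Ω (1 / δ) fun x => w x ^ (-δ) := by
  obtain ⟨C, hC, h⟩ := h
  refine ⟨C ^ δ, ENNReal.rpow_ne_top_of_nonneg hδ.le hC, fun Q hQ hQΩ => ?_⟩
  have e : cubeAvg Q (fun x => (w x ^ (-δ)) ^ (-(1 / δ))) = cubeAvg Q w :=
    cubeAvg_congr_of_pos hw.pos hQΩ fun x hx => by
      rw [← Real.rpow_mul hx.le, neg_mul_neg, mul_one_div_cancel hδ.ne', Real.rpow_one]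
  rw [e, one_div_one_div]
  calc _ = (cubeAvg Q w * cubeAvg Q (fun x => w x ^ (-δ)) ^ (1 / δ)) ^ δ := by
        rw [ENNReal.mul_rpow_of_nonneg _ _ hδ.le, ← ENNReal.rpow_mul,
          one_div_mul_cancel hδ.ne', ENNReal.rpow_one, mul_comm]
    _ ≤ _ := by
        gcongr
        exact h Q hQ hQΩ

lemma ApCond.exists_reverse_holder_dual {δ : ℝ} (h : ApCond Ω δ w) (hw : IsWeight Ω w)
    (hδ : 0 < δ) :
    ∃ ε₀ : ℝ, 0 < ε₀ ∧ ∀ ε, 0 < ε → ε ≤ ε₀ → ∀ Q, IsCube Q → Q ⊆ Ω →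
      cubeAvg Q (fun x => (w x ^ (-δ)) ^ (1 + ε)) ≤
        2 * cubeAvg Q (fun x => w x ^ (-δ)) ^ (1 + ε) :=
  (h.dual hw hδ).exists_reverse_holder
    (hw.rpow fun _ hQ hQΩ => h.cubeAvg_rpow_neg_ne_top hw hδ hQ hQΩ) (by positivity)

lemma ApCond.exists_lt {δ : ℝ} (h : ApCond Ω δ w) (hw : IsWeight Ω w) (hδ : 0 < δ) :
    ∃ δ', δ < δ' ∧ ApCond Ω δ' w := by
  obtain ⟨ε, hε, hle⟩ := h.exists_reverse_holder_dual hw hδ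
  obtain ⟨C, hC, h⟩ := h
  have hpos : 0 ≤ 1 / (δ * (1 + ε)) := by positivity
  refine ⟨δ * (1 + ε), by nlinarith, 2 ^ (1 / (δ * (1 + ε))) * C, by finiteness,
    fun Q hQ hQΩ => ?_⟩
  have e : cubeAvg Q (fun x => w x ^ (-(δ * (1 + ε)))) =
      cubeAvg Q fun x => (w x ^ (-δ)) ^ (1 + ε) :=
    cubeAvg_congr_of_pos hw.pos hQΩ fun x hx => by rw [← Real.rpow_mul hx.le, neg_mul]
  rw [e]
  calc _ ≤ cubeAvg Q w *
        (2 * cubeAvg Q (fun x => w x ^ (-δ)) ^ (1 + ε)) ^ (1 / (δ * (1 + ε))) := by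
        gcongr
        exact hle ε hε le_rfl Q hQ hQΩ
    _ = 2 ^ (1 / (δ * (1 + ε))) *
        (cubeAvg Q w * cubeAvg Q (fun x => w x ^ (-δ)) ^ (1 / δ)) := by
        rw [ENNReal.mul_rpow_of_nonneg _ _ hpos, ← ENNReal.rpow_mul,
          show (1 + ε) * (1 / (δ * (1 + ε))) = 1 / δ by field_simp]
        ring
    _ ≤ _ := by
        gcongr
        exact h Q hQ hQΩ

variable {p : ℝ}

lemma MemA.isWeight (h : MemA Ω p w) : IsWeight Ω w :=
  h.elim (fun h => h.2.1) fun h => h.2.1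

lemma MemA.rpow_of_le_one (h : MemA Ω p w) {θ : ℝ} (hθ : 0 < θ) (hθ1 : θ ≤ 1) :
    MemA Ω p fun x => w x ^ θ := by
  have hw := h.isWeight
  have hle : ∀ Q, IsCube Q → Q ⊆ Ω → cubeAvg Q (fun x => w x ^ θ) ≤ 1 * cubeAvg Q w ^ θ :=
    fun Q hQ hQΩ => by
      rw [one_mul]
      exact cubeAvg_rpow_le hw.measurable hw.pos hQ hQΩ hθ hθ1
  rcases h with ⟨hp, h⟩ | ⟨hp, h⟩
  · exact .inl ⟨hp, h.rpow_of_avg_le hθ one_ne_top hle⟩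
  · refine .inr ⟨hp, (memApGT1_iff hp).2 ⟨hw.rpow_of_le_one hθ hθ1, ?_⟩⟩
    refine ((memApGT1_iff hp).1 h).2.rpow_of_avg_le (one_div_pos.2 (sub_pos.2 hp)) hw.pos hθ
      one_ne_top hle fun Q hQ hQΩ => ?_
    rw [one_mul]
    exact cubeAvg_rpow_le (hw.measurable.pow_const _)
      (hw.pos.mono fun x hx => Real.rpow_pos_of_pos hx _) hQ hQΩ hθ hθ1

lemma MemA.exists_rpow_one_add (h : MemA Ω p w) :
    ∃ ε : ℝ, 0 < ε ∧ MemA Ω p fun x => w x ^ (1 + ε) := by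
  have hw := h.isWeight
  rcases h with ⟨hp, h⟩ | ⟨hp, h⟩
  · obtain ⟨ε, hε, hle⟩ := (h.apCond one_pos).exists_reverse_holder hw one_pos
    exact ⟨ε, hε, .inl ⟨hp, h.rpow_of_avg_le (by positivity) ofNat_ne_top (hle ε hε le_rfl)⟩⟩
  · have hδ : 0 < 1 / (p - 1) := one_div_pos.2 (sub_pos.2 hp)
    have hA := ((memApGT1_iff hp).1 h).2
    obtain ⟨ε₁, hε₁, hle₁⟩ := hA.exists_reverse_holder hw hδ
    obtain ⟨ε₂, hε₂, hle₂⟩ := hA.exists_reverse_holder_dual hw hδ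
    have hε : 0 < min ε₁ ε₂ := lt_min hε₁ hε₂
    have hle := hle₁ _ hε (min_le_left _ _)
    refine ⟨min ε₁ ε₂, hε, .inr ⟨hp, (memApGT1_iff hp).2 ⟨hw.rpow fun Q hQ hQΩ => ?_,
      hA.rpow_of_avg_le hδ hw.pos (by positivity) ofNat_ne_top hle
        (hle₂ _ hε (min_le_right _ _))⟩⟩⟩
    exact ne_top_of_le_ne_top (ENNReal.mul_ne_top ofNat_ne_top (ENNReal.rpow_ne_top_of_nonneg
      (by positivity) (hw.cubeAvg_ne_top hQ hQΩ))) (hle Q hQ hQΩ)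

lemma MemA.of_lt {q : ℝ} (h : MemA Ω q w) (hqp : q < p) : MemA Ω p w := by
  have hw := h.isWeight
  rcases h with ⟨rfl, h⟩ | ⟨hq, h⟩
  · exact .inr ⟨hqp, (memApGT1_iff hqp).2 ⟨hw, h.apCond (one_div_pos.2 (sub_pos.2 hqp))⟩⟩
  · have hp := hq.trans hqp
    refine .inr ⟨hp, (memApGT1_iff hp).2 ⟨hw, ((memApGT1_iff hq).1 h).2.of_le hw
      (one_div_pos.2 (sub_pos.2 hp)) ?_⟩⟩
    exact one_div_le_one_div_of_le (sub_pos.2 hq) (by linarith)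

lemma MemA.exists_lt (h : MemA Ω p w) (hp : 1 < p) : ∃ q, 1 ≤ q ∧ q < p ∧ MemA Ω q w := by
  have hw := h.isWeight
  obtain ⟨rfl, -⟩ | ⟨-, h⟩ := h
  · exact absurd hp (lt_irrefl _)
  have hδ : 0 < 1 / (p - 1) := one_div_pos.2 (sub_pos.2 hp)
  obtain ⟨δ, hlt, hA⟩ := ((memApGT1_iff hp).1 h).2.exists_lt hw hδ
  have hδ0 := hδ.trans hlt
  have hq : 1 < 1 + 1 / δ := by
    have : 0 < 1 / δ := one_div_pos.2 hδ0
    linarith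
  refine ⟨1 + 1 / δ, hq.le, ?_, .inr ⟨hq, (memApGT1_iff hq).2 ⟨hw, ?_⟩⟩⟩
  · have := (one_div_lt hδ0 (sub_pos.2 hp)).2 hlt
    linarith
  · rwa [add_sub_cancel_left, one_div_one_div]

lemma HasApPowMajorant.of_rpow {r s θ : ℝ} {f : (Fin n → ℝ) → ℝ} (hf : Measurable f)
    (hθ : 0 < θ) (hs : s = r * θ) (hw : MemA Ω p fun x => w x ^ θ)
    (hle : ∀ᵐ x ∂volume.restrict Ω, |f x| ^ r ≤ w x) : HasApPowMajorant Ω p s f := by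
  refine ⟨hf, _, hw, hle.mono fun x hx => ?_⟩
  rw [hs, Real.rpow_mul (abs_nonneg _)]
  exact Real.rpow_le_rpow (by positivity) hx hθ.le

end Muckenhoupt

theorem stmt15 (n : ℕ) (Ω : Set (Fin n → ℝ)) (hΩ : IsAdmissibleDomain Ω)
    (r p : ℝ) (hr : 0 < r) (hp : 1 ≤ p) :
    ({f : (Fin n → ℝ) → ℝ | HasApPowMajorant Ω p r f} =
      {f | ∃ s, r < s ∧ HasApPowMajorant Ω p s f}) ∧
    (1 < p →
      {f : (Fin n → ℝ) → ℝ | HasApPowMajorant Ω p r f} =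
        {f | ∃ q, 1 ≤ q ∧ q < p ∧ HasApPowMajorant Ω q r f}) := by
  have hs : ∀ f : (Fin n → ℝ) → ℝ, HasApPowMajorant Ω p r f ↔
      ∃ s, r < s ∧ HasApPowMajorant Ω p s f := by
    intro f
    constructor
    · rintro ⟨hf, w, hw, hle⟩
      obtain ⟨ε, hε, hwε⟩ := hw.exists_rpow_one_add
      exact ⟨r * (1 + ε), by nlinarith, .of_rpow hf (by positivity) rfl hwε hle⟩
    · rintro ⟨s, hrs, hf, w, hw, hle⟩
      have hs0 := hr.trans hrs
      exact .of_rpow hf (div_pos hr hs0) (mul_div_cancel₀ r hs0.ne').symm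
        (hw.rpow_of_le_one (div_pos hr hs0) ((div_le_one hs0).2 hrs.le)) hle
  refine ⟨Set.ext hs, fun hp1 => Set.ext fun f => ⟨?_, ?_⟩⟩
  · rintro ⟨hf, w, hw, hle⟩
    obtain ⟨q, hq1, hqp, hwq⟩ := hw.exists_lt hp1
    exact ⟨q, hq1, hqp, hf, w, hwq, hle⟩
  · rintro ⟨q, -, hqp, hf, w, hw, hle⟩
    exact ⟨hf, w, hw.of_lt hqp, hle⟩
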